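/- arXiv:1610.07645 — 2 statements merged into one kernel-verified Lean document; each statement's English description precedes it below -/
import Mathlib

section
/- Let A be a finite group and (ρ, V) a nonzero finite-dimensional complex representation of A. Suppose there is an element c ∈ A with c ≠ 1 and ρ(c) = −id_V, suppose every element x ∈ A with x ∉ {1, c} is conjugate in A to x·c, and suppose |A| = 2·(dim V)². Then V is an irreducible representation of A. -/
namespace Representation

variable {k G V : Type*} [Field k] [CharZero k] [Group G] [AddCommGroup V] [Module k V]

/-- If `c` acts by `-1` then the character vanishes at every `x` conjugate to `x * c`. -/
theorem character_eq_zero_of_isConj_mul (ρ : Representation k G V) {c x : G}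
    (hc : ρ c = -LinearMap.id) (hx : IsConj x (x * c)) : ρ.character x = 0 := by
  obtain ⟨g, hg⟩ := isConj_iff.mp hx
  have h : ρ.character (x * c) = -ρ.character x := by
    have hmul : ρ x * -LinearMap.id = -ρ x := by ext; simp
    rw [character, map_mul, hc, hmul, map_neg, character]
  rw [← hg, char_conj] at h
  exact self_eq_neg.mp h

/-- If `c` acts by `-1` on `ρ` and `σ` and every `x ∉ {1, c}` is conjugate to `x * c`, then
only `1` and `c` contribute to the scalar product of the characters. -/
theorem sum_character_mul_character_inv [Fintype G] [FiniteDimensional k V]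
    {W : Type*} [AddCommGroup W] [Module k W] [FiniteDimensional k W]
    (ρ : Representation k G V) (σ : Representation k G W) {c : G} (hc1 : c ≠ 1)
    (hρ : ρ c = -LinearMap.id) (hσ : σ c = -LinearMap.id)
    (hconj : ∀ x : G, x ≠ 1 → x ≠ c → IsConj x (x * c)) :
    ∑ g : G, σ.character g * ρ.character g⁻¹ = 2 * Module.finrank k V * Module.finrank k W := by
  classical
  have hinv : ρ c⁻¹ = -LinearMap.id := by
    have h : ρ c * ρ c⁻¹ = 1 := by rw [← map_mul, mul_inv_cancel, map_one]
    rw [hρ] at h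
    ext v
    have hv := LinearMap.congr_fun h v
    simp only [Module.End.mul_apply, LinearMap.neg_apply, LinearMap.id_apply,
      Module.End.one_apply] at hv ⊢
    rw [neg_eq_iff_eq_neg.mp hv]
  rw [← Finset.sum_subset (Finset.subset_univ {1, c}), Finset.sum_pair hc1.symm]
  · rw [inv_one, char_one, char_one]
    simp only [character, hσ, hinv, map_neg, LinearMap.trace_id]
    ring
  · intro x _ hx
    simp only [Finset.mem_insert, Finset.mem_singleton, not_or] at hx
    rw [character_eq_zero_of_isConj_mul σ hσ (hconj x hx.1 hx.2), zero_mul]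

end Representation

/-- Let `A` be a finite group and `(ρ, V)` a nonzero finite-dimensional complex
representation of `A`.  If there is `c ∈ A`, `c ≠ 1`, acting by `-id`, every element
`x ∉ {1, c}` is conjugate to `x * c`, and `|A| = 2 * (dim V)^2`, then `V` is an
irreducible representation of `A` (its only `A`-stable subspaces are `⊥` and `⊤`). -/
theorem irreducible_of_neg_one_central_conj_and_card
    {A : Type*} [Group A] [Fintype A]
    {V : Type*} [AddCommGroup V] [Module ℂ V] [FiniteDimensional ℂ V] [Nontrivial V]
    (ρ : Representation ℂ A V)
    (c : A) (hc1 : c ≠ 1) (hc : ρ c = -LinearMap.id)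
    (hconj : ∀ x : A, x ≠ 1 → x ≠ c → IsConj x (x * c))
    (hcard : Fintype.card A = 2 * (Module.finrank ℂ V) ^ 2) :
    ∀ W : Submodule ℂ V, (∀ a : A, ∀ v ∈ W, ρ a v ∈ W) → W = ⊥ ∨ W = ⊤ := by
  intro W hW
  let τ : Representation ℂ A W :=
    (⟨W, fun a _ hv => hW a _ hv⟩ : Subrepresentation ρ).toRepresentation
  have hτ : τ c = -LinearMap.id := by
    ext v
    change ρ c v = _
    simp [hc]
  have : Invertible (Nat.card A : ℂ) := invertibleOfNonzero (by simp)
  have h := Representation.card_inv_mul_sum_char_mul_char_eq_finrank ρ τ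
  rw [Representation.sum_character_mul_character_inv ρ τ hc1 hc hτ hconj,
    Nat.card_eq_fintype_card, hcard] at h
  have hd : 0 < Module.finrank ℂ V := Module.finrank_pos
  have hd' : (Module.finrank ℂ V : ℂ) ≠ 0 := by exact_mod_cast hd.ne'
  have hdvd : Module.finrank ℂ V ∣ Module.finrank ℂ W := by
    refine ⟨Module.finrank ℂ (Representation.IntertwiningMap ρ τ), ?_⟩
    push_cast at h
    field_simp at h
    exact_mod_cast h
  rcases Nat.eq_zero_or_pos (Module.finrank ℂ W) with h0 | hpos
  · exact Or.inl (Submodule.finrank_eq_zero.mp h0)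
  · exact Or.inr (Submodule.eq_top_of_finrank_eq
      (le_antisymm (Submodule.finrank_le W) (Nat.le_of_dvd hpos hdvd)))
end

section
/- Let λ_1 ≥ λ_2 ≥ … ≥ λ_k ≥ 1 be integers with λ_1 + … + λ_k = l, let d = gcd(λ_1, …, λ_k), and let e be the nilpotent l×l complex matrix in Jordan form with blocks of sizes λ_1, …, λ_k. Let Z = { g ∈ SL_l(ℂ) : g·e = e·g }, the centralizer of e in the special linear group, regarded as a topological group with the topology induced from the space of l×l complex matrices. Then the component group Z / Z° of Z, where Z° is the connected component of the identity, is a cyclic group of order d. -/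
theorem Matrix.isConnected_setOf_det_one_add_smul_ne_zero {n : Type*} [Fintype n] [DecidableEq n]
    (M : Matrix n n ℂ) : IsConnected {z : ℂ | (1 + z • M).det ≠ 0} := by
  have hfin : {z : ℂ | (1 + z • M).det = 0}.Finite := by
    let P : Polynomial ℂ :=
      ((1 : Matrix n n ℂ).map Polynomial.C + (Polynomial.X : Polynomial ℂ) • M.map Polynomial.C).det
    have hP : ∀ z, P.eval z = (1 + z • M).det := by
      intro z
      rw [← Polynomial.coe_evalRingHom, RingHom.map_det]
      congr 1
      ext i j
      simp only [Polynomial.coe_evalRingHom, RingHom.mapMatrix_apply, Matrix.map_apply, Matrix.add_apply,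
        Matrix.smul_apply, smul_eq_mul, Polynomial.eval_add, Polynomial.eval_mul, Polynomial.eval_C,
        Polynomial.eval_X]
    have hP0 : P ≠ 0 := by
      intro h
      have := hP 0
      simp [h] at this
    refine (P.roots.toFinset.finite_toSet).subset fun z hz => ?_
    simpa [hP0, hP] using hz
  exact hfin.countable.isConnected_compl_of_one_lt_rank (by simp)

theorem Matrix.continuous_units_of_continuous_val {X n : Type*} [TopologicalSpace X] [Fintype n]
    [DecidableEq n] {f : X → (Matrix n n ℂ)ˣ}
    (hf : Continuous fun x => (f x : Matrix n n ℂ)) : Continuous f := by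
  refine Units.continuous_iff.2 ⟨hf, ?_⟩
  have h : (fun x => ((f x)⁻¹ : (Matrix n n ℂ)ˣ).val) =
      fun x => ((f x).val.det)⁻¹ • (f x).val.adjugate := by
    funext x
    rw [Matrix.coe_units_inv, Matrix.inv_def, Ring.inverse_eq_inv']
  rw [h]
  refine Continuous.smul (hf.matrix_det.inv₀ fun x => ?_) hf.matrix_adjugate
  exact ((Matrix.isUnit_iff_isUnit_det _).1 (f x).isUnit).ne_zero

/-- If `χ` is a continuous multiplicative function on a matrix algebra `C` with `χ ^ d = det`,
split by a one-parameter subgroup `s`, then the component group of the group of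
determinant-one elements of `C` is cyclic of order `d`. -/
theorem isCyclic_componentGroup_of_pow_eq_det {n : Type*} [Fintype n] [DecidableEq n] {d : ℕ}
    (hd : d ≠ 0) (C : Subalgebra ℂ (Matrix n n ℂ)) (χ : Matrix n n ℂ → ℂ) (hχ : Continuous χ)
    (hχ_one : χ 1 = 1) (hχ_mul : ∀ x ∈ C, ∀ y ∈ C, χ (x * y) = χ x * χ y)
    (hχ_pow : ∀ x ∈ C, χ x ^ d = x.det)
    (s : ℂˣ →* (Matrix n n ℂ)ˣ) (hs : Continuous s) (hsC : ∀ t, (s t : Matrix n n ℂ) ∈ C)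
    (hχs : ∀ t, χ (s t) = t)
    (Z : Subgroup (Matrix n n ℂ)ˣ)
    (hZ : ∀ g : (Matrix n n ℂ)ˣ, g ∈ Z ↔ (g : Matrix n n ℂ).det = 1 ∧ (g : Matrix n n ℂ) ∈ C)
    (Z₀ : Subgroup Z) (hZ₀ : (Z₀ : Set Z) = connectedComponent 1) [Z₀.Normal] :
    IsCyclic (Z ⧸ Z₀) ∧ Nat.card (Z ⧸ Z₀) = d := by
  have : NeZero d := ⟨hd⟩
  have hC : ∀ z : Z, (z.1 : Matrix n n ℂ) ∈ C := fun z => ((hZ _).1 z.2).2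
  have hpow : ∀ z : Z, χ z.1 ^ d = 1 := fun z => by
    rw [hχ_pow _ (hC z), ((hZ _).1 z.2).1]
  let f : Z →* ℂ :=
    { toFun := fun z => χ z.1
      map_one' := by simpa using hχ_one
      map_mul' := fun x y => by simpa using hχ_mul _ (hC x) _ (hC y) }
  let ψ : Z →* rootsOfUnity d ℂ := f.toHomUnits.codRestrict (rootsOfUnity d ℂ) fun z => by
    rw [mem_rootsOfUnity]
    ext
    exact hpow z
  have hψ : ∀ z, ((ψ z : ℂˣ) : ℂ) = χ z.1 := fun z => rfl
  have hcont : Continuous fun z : Z => χ z.1 :=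
    hχ.comp (Units.continuous_val.comp continuous_subtype_val)
  have hker : ∀ z : Z, z ∈ ψ.ker ↔ χ z.1 = 1 := fun z => by
    rw [MonoidHom.mem_ker, ← hψ, ← Subtype.coe_inj, ← Units.val_inj]
    simp
  have hsurj : Function.Surjective ψ := by
    rintro ⟨t, ht⟩
    have ht' : (t : ℂ) ^ d = 1 := by
      rw [mem_rootsOfUnity] at ht
      simpa using congrArg Units.val ht
    refine ⟨⟨s t, (hZ _).2 ⟨?_, hsC t⟩⟩, ?_⟩
    · rw [← hχ_pow _ (hsC t), hχs, ht']
    · apply Subtype.ext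
      apply Units.ext
      rw [hψ, hχs]
  have hZker : Z₀ = ψ.ker := by
    apply SetLike.coe_injective
    rw [hZ₀]
    apply Set.Subset.antisymm
    · intro z hz
      have hpre : IsPreconnected ((fun z : Z => χ z.1) '' connectedComponent 1) :=
        isPreconnected_connectedComponent.image _ hcont.continuousOn
      have hfin : ((fun z : Z => χ z.1) '' connectedComponent 1).Finite := by
        refine ((Polynomial.nthRoots d (1 : ℂ)).toFinset.finite_toSet).subset ?_
        rintro _ ⟨z, -, rfl⟩
        simpa [Polynomial.mem_nthRoots (Nat.pos_of_ne_zero hd)] using hpow z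
      have := (hfin.countable.isTotallyDisconnected _ subset_rfl hpre)
        ⟨z, hz, rfl⟩ ⟨1, mem_connectedComponent, rfl⟩
      refine (hker z).2 (this.trans ?_)
      simpa using hχ_one
    · intro g hg
      have hg1 : χ g.1 = 1 := (hker g).1 hg
      let M : Matrix n n ℂ := (g.1 : Matrix n n ℂ) - 1
      let S : Set ℂ := {z : ℂ | (1 + z • M).det ≠ 0}
      have : ConnectedSpace S :=
        Subtype.connectedSpace (Matrix.isConnected_setOf_det_one_add_smul_ne_zero M)
      have hMC : ∀ z : ℂ, 1 + z • M ∈ C := fun z =>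
        C.add_mem C.one_mem (C.smul_mem (C.sub_mem (hC g) C.one_mem) z)
      let γ : S → (Matrix n n ℂ)ˣ := fun z =>
        Matrix.nonsingInvUnit (1 + z.1 • M) (isUnit_iff_ne_zero.2 z.2)
      have hγv : ∀ z, (γ z : Matrix n n ℂ) = 1 + z.1 • M := fun z => rfl
      have hγ : Continuous γ := Matrix.continuous_units_of_continuous_val (by
        simp only [hγv]
        fun_prop)
      have hγC : ∀ z, (γ z : Matrix n n ℂ) ∈ C := fun z => hMC z
      have hχγ : ∀ z, χ (γ z) ≠ 0 := fun z h => z.2 (by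
        rw [← hγv, ← hχ_pow _ (hγC z), h, zero_pow hd])
      let c : S → ℂˣ := fun z => Units.mk0 (χ (γ z)) (hχγ z)
      have hc : Continuous c := by
        refine Units.continuous_iff.2 ⟨hχ.comp (Units.continuous_val.comp hγ), ?_⟩
        have : (fun z => ((c z)⁻¹ : ℂˣ).val) = fun z => (χ (γ z))⁻¹ := by
          funext z
          simp [c]
        exact this ▸ (hχ.comp (Units.continuous_val.comp hγ)).inv₀ hχγ
      have hmem : ∀ z, γ z * s (c z)⁻¹ ∈ Z := fun z => by
        have hmC : ((γ z * s (c z)⁻¹ : (Matrix n n ℂ)ˣ) : Matrix n n ℂ) ∈ C :=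
          C.mul_mem (hγC z) (hsC _)
        refine (hZ _).2 ⟨?_, hmC⟩
        rw [← hχ_pow _ hmC, Units.val_mul, hχ_mul _ (hγC z) _ (hsC _), hχs]
        simp [c, hχγ]
      let F : S → Z := fun z => ⟨γ z * s (c z)⁻¹, hmem z⟩
      have hF : Continuous F := (hγ.mul (hs.comp hc.inv)).subtype_mk _
      have hc_one : ∀ z, χ (γ z) = 1 → c z = 1 := fun z h => Units.ext h
      have h0 : (0 : ℂ) ∈ S := by simp [S]
      have h1 : (1 : ℂ) ∈ S := by
        simp only [S, M, Set.mem_ofPred_eq, one_smul, add_sub_cancel]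
        rw [((hZ _).1 g.2).1]
        exact one_ne_zero
      have hγ0 : γ ⟨0, h0⟩ = 1 := Units.ext (by simp [hγv])
      have hγ1 : γ ⟨1, h1⟩ = g.1 := Units.ext (by simp [hγv, M])
      have hF0 : F ⟨0, h0⟩ = 1 := Subtype.ext (by
        simp only [F]
        rw [hc_one _ (by rw [hγ0]; simpa using hχ_one), hγ0]
        simp)
      have hF1 : F ⟨1, h1⟩ = g := Subtype.ext (by
        simp only [F]
        rw [hc_one _ (by rw [hγ1, hg1]), hγ1]
        simp)
      exact (isPreconnected_range hF).subset_connectedComponent ⟨_, hF0⟩ ⟨_, hF1⟩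
  subst hZker
  let E : Z ⧸ ψ.ker ≃* rootsOfUnity d ℂ := QuotientGroup.quotientKerEquivOfSurjective ψ hsurj
  refine ⟨isCyclic_of_surjective E.symm E.symm.surjective, ?_⟩
  rw [Nat.card_congr E.toEquiv, Complex.card_rootsOfUnity]

section

variable {ι : Type*} [Fintype ι] [DecidableEq ι] {lam : ι → ℕ}

theorem Matrix.BlockTriangular.toSquareBlock_mul {m α R : Type*} [Fintype m] [LinearOrder α]
    [NonUnitalNonAssocSemiring R] {M N : Matrix m m R} {b : m → α}
    (hM : M.BlockTriangular b) (hN : N.BlockTriangular b) (a : α) :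
    (M * N).toSquareBlock b a = M.toSquareBlock b a * N.toSquareBlock b a := by
  ext ⟨i, hi⟩ ⟨j, hj⟩
  simp only [Matrix.toSquareBlock_def, Matrix.of_apply, Matrix.mul_apply]
  rw [← Fintype.sum_subtype_add_sum_subtype (fun x => b x = a)]
  refine (congrArg _ (Finset.sum_eq_zero fun x _ => ?_)).trans (add_zero _)
  rcases lt_or_gt_of_ne x.2 with hx | hx
  · rw [hM (hi ▸ hx), zero_mul]
  · rw [hN (hj ▸ hx), mul_zero]

theorem Finset.prod_zpow_eq_zpow_sum {α G : Type*} [CommGroup G] (s : Finset α) (f : α → ℤ)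
    (t : G) : ∏ a ∈ s, t ^ f a = t ^ ∑ a ∈ s, f a := by
  classical
  induction s using Finset.induction_on with
  | empty => simp
  | insert a s ha ih => rw [Finset.prod_insert ha, Finset.sum_insert ha, ih, zpow_add]

variable (lam) in
/-- The nilpotent Jordan matrix with blocks of sizes `lam i`, indexed by block and position. -/
def nilpotentJordan : Matrix (Σ i, Fin (lam i)) (Σ i, Fin (lam i)) ℂ :=
  Matrix.of fun a b => if a.1 = b.1 ∧ (b.2 : ℕ) = a.2 + 1 then 1 else 0

/-- The position of an index inside its Jordan block. -/
def jordanHeight (a : Σ i, Fin (lam i)) : ℕ := a.2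

theorem mul_nilpotentJordan_apply_succ (g : Matrix (Σ i, Fin (lam i)) (Σ i, Fin (lam i)) ℂ)
    (a : Σ i, Fin (lam i)) (j : ι) (p : ℕ) (hp : p + 1 < lam j) :
    (g * nilpotentJordan lam) a ⟨j, p + 1, hp⟩ = g a ⟨j, p, by omega⟩ := by
  rw [Matrix.mul_apply, Finset.sum_eq_single ⟨j, p, by omega⟩]
  · simp [nilpotentJordan]
  · rintro ⟨i, q, hq⟩ - h
    simp only [nilpotentJordan, Matrix.of_apply, mul_ite, mul_one, mul_zero, ite_eq_right_iff]
    rintro ⟨rfl, h'⟩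
    exact absurd (by simpa using h'.symm) h
  · simp

theorem mul_nilpotentJordan_apply_zero (g : Matrix (Σ i, Fin (lam i)) (Σ i, Fin (lam i)) ℂ)
    (a : Σ i, Fin (lam i)) (j : ι) (hp : 0 < lam j) :
    (g * nilpotentJordan lam) a ⟨j, 0, hp⟩ = 0 := by
  simp [Matrix.mul_apply, nilpotentJordan]

theorem nilpotentJordan_mul_apply (g : Matrix (Σ i, Fin (lam i)) (Σ i, Fin (lam i)) ℂ)
    (b : Σ i, Fin (lam i)) (i : ι) (p : ℕ) (hp : p + 1 < lam i) :
    (nilpotentJordan lam * g) ⟨i, p, by omega⟩ b = g ⟨i, p + 1, hp⟩ b := by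
  rw [Matrix.mul_apply, Finset.sum_eq_single ⟨i, p + 1, hp⟩]
  · simp [nilpotentJordan]
  · rintro ⟨i, q, hq⟩ - h
    simp only [nilpotentJordan, Matrix.of_apply, ite_mul, one_mul, zero_mul, ite_eq_right_iff]
    rintro ⟨rfl, rfl⟩
    exact absurd rfl h
  · simp

variable {g : Matrix (Σ i, Fin (lam i)) (Σ i, Fin (lam i)) ℂ}

theorem apply_succ_succ_of_commute (hg : Commute g (nilpotentJordan lam))
    (i j : ι) (p q : ℕ) (hp : p + 1 < lam i) (hq : q + 1 < lam j) :
    g ⟨i, p + 1, hp⟩ ⟨j, q + 1, hq⟩ = g ⟨i, p, by omega⟩ ⟨j, q, by omega⟩ := by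
  exact (nilpotentJordan_mul_apply g _ i p hp).symm.trans
    ((congrFun₂ hg.eq _ _).symm.trans (mul_nilpotentJordan_apply_succ g _ j q hq))

theorem blockTriangular_of_commute (hg : Commute g (nilpotentJordan lam)) :
    g.BlockTriangular jordanHeight := by
  rintro ⟨i, p, hp⟩ ⟨j, q, hq⟩ h
  change q < p at h
  induction q generalizing p with
  | zero =>
    obtain ⟨p, rfl⟩ := Nat.exists_eq_succ_of_ne_zero h.ne'
    exact (nilpotentJordan_mul_apply g _ i p hp).symm.trans
      ((congrFun₂ hg.eq _ _).symm.trans (mul_nilpotentJordan_apply_zero g _ j hq))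
  | succ q ih =>
    obtain ⟨p, rfl⟩ := Nat.exists_eq_succ_of_ne_zero (Nat.ne_zero_of_lt h)
    exact (apply_succ_succ_of_commute hg i j p q hp hq).trans (ih _ _ _ (by omega))

theorem det_toSquareBlock_succ (hg : Commute g (nilpotentJordan lam)) (p : ℕ)
    (hp : ∀ i, lam i ≠ p + 1) :
    (g.toSquareBlock jordanHeight (p + 1)).det = (g.toSquareBlock jordanHeight p).det := by
  let E : {a : Σ i, Fin (lam i) // jordanHeight a = p} ≃
      {a : Σ i, Fin (lam i) // jordanHeight a = p + 1} :=
    { toFun := fun a => ⟨⟨a.1.1, p + 1, by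
        have h1 := a.1.2.2
        have h2 : (a.1.2 : ℕ) = p := a.2
        have h3 := hp a.1.1
        omega⟩, rfl⟩
      invFun := fun a => ⟨⟨a.1.1, p, by
        have h1 := a.1.2.2
        have h2 : (a.1.2 : ℕ) = p + 1 := a.2
        omega⟩, rfl⟩
      left_inv := by
        rintro ⟨⟨i, q, hq⟩, rfl⟩
        rfl
      right_inv := by
        rintro ⟨⟨i, q, hq⟩, h⟩
        obtain rfl : q = p + 1 := h
        rfl }
  rw [← Matrix.det_submatrix_equiv_self E]
  congr 1
  ext ⟨⟨i, q, hq⟩, rfl⟩ ⟨⟨j, r, hr⟩, h⟩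
  obtain rfl : r = q := h
  exact apply_succ_succ_of_commute hg _ _ _ _ _ _

/-- The product of the determinants of the diagonal blocks of height `0, d, …, d * (M - 1)`. -/
def jordanChar (d M : ℕ) (g : Matrix (Σ i, Fin (lam i)) (Σ i, Fin (lam i)) ℂ) : ℂ :=
  ∏ q ∈ Finset.range M, (g.toSquareBlock jordanHeight (d * q)).det

theorem continuous_jordanChar (d M : ℕ) : Continuous (jordanChar (lam := lam) d M) := by
  refine continuous_finsetProd _ fun q _ => Continuous.matrix_det ?_
  exact continuous_matrix fun i j => continuous_id.matrix_elem _ _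

theorem jordanChar_mul (d M : ℕ) {g h : Matrix (Σ i, Fin (lam i)) (Σ i, Fin (lam i)) ℂ}
    (hg : Commute g (nilpotentJordan lam)) (hh : Commute h (nilpotentJordan lam)) :
    jordanChar d M (g * h) = jordanChar d M g * jordanChar d M h := by
  simp only [jordanChar, ← Finset.prod_mul_distrib]
  refine Finset.prod_congr rfl fun q _ => ?_
  rw [(blockTriangular_of_commute hg).toSquareBlock_mul (blockTriangular_of_commute hh),
    Matrix.det_mul]

theorem det_toSquareBlock_mul_add (hg : Commute g (nilpotentJordan lam)) {d : ℕ}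
    (hd : ∀ i, d ∣ lam i) (q r : ℕ) (hr : r < d) :
    (g.toSquareBlock jordanHeight (d * q + r)).det =
      (g.toSquareBlock jordanHeight (d * q)).det := by
  induction r with
  | zero => rfl
  | succ r ih =>
    rw [← add_assoc, det_toSquareBlock_succ hg, ih (by omega)]
    intro i h
    have h1 : d ∣ d * q + (r + 1) := by
      rw [← add_assoc, ← h]
      exact hd i
    exact absurd (Nat.le_of_dvd (by omega) ((Nat.dvd_add_right (dvd_mul_right d q)).1 h1))
      (by omega)

theorem jordanChar_pow (hg : Commute g (nilpotentJordan lam)) {d M : ℕ}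
    (hd : ∀ i, d ∣ lam i) (hM : ∀ i, lam i ≤ d * M) :
    jordanChar d M g ^ d = g.det := by
  have hrange : ∀ M, ∏ p ∈ Finset.range (d * M), (g.toSquareBlock jordanHeight p).det =
      jordanChar d M g ^ d := by
    intro M
    induction M with
    | zero => simp [jordanChar]
    | succ M ih =>
      rw [mul_add_one, Finset.prod_range_add, ih, jordanChar, jordanChar,
        Finset.prod_range_succ, mul_pow]
      congr 1
      rw [Finset.prod_congr rfl fun r hr =>
        det_toSquareBlock_mul_add hg hd M r (Finset.mem_range.1 hr)]
      simp
  rw [← hrange, (blockTriangular_of_commute hg).det]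
  symm
  refine Finset.prod_subset ?_ fun p _ hp => ?_
  · intro p hp
    obtain ⟨a, -, rfl⟩ := Finset.mem_image.1 hp
    exact Finset.mem_range.2 (a.2.2.trans_le (hM a.1))
  · have : IsEmpty {a : Σ i, Fin (lam i) // jordanHeight a = p} :=
      ⟨fun a => hp (Finset.mem_image.2 ⟨a.1, Finset.mem_univ _, a.2⟩)⟩
    exact Matrix.det_isEmpty

/-- The one-parameter subgroup acting on the `i`-th Jordan block by the scalar `t ^ c i`. -/
def jordanTorus (c : ι → ℤ) :
    ℂˣ →* (Matrix (Σ i, Fin (lam i)) (Σ i, Fin (lam i)) ℂ)ˣ where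
  toFun t :=
    { val := Matrix.diagonal fun a => ((t ^ c a.1 : ℂˣ) : ℂ)
      inv := Matrix.diagonal fun a => ((t⁻¹ ^ c a.1 : ℂˣ) : ℂ)
      val_inv := by
        rw [Matrix.diagonal_mul_diagonal, ← Matrix.diagonal_one]
        congr 1
        funext a
        rw [← Units.val_mul, ← mul_zpow, mul_inv_cancel, one_zpow, Units.val_one]
      inv_val := by
        rw [Matrix.diagonal_mul_diagonal, ← Matrix.diagonal_one]
        congr 1
        funext a
        rw [← Units.val_mul, ← mul_zpow, inv_mul_cancel, one_zpow, Units.val_one] }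
  map_one' := Units.ext (by simp)
  map_mul' x y := Units.ext (by simp [mul_zpow])

theorem coe_jordanTorus (c : ι → ℤ) (t : ℂˣ) :
    (jordanTorus (lam := lam) c t).val =
      Matrix.diagonal fun a => ((t ^ c a.1 : ℂˣ) : ℂ) := rfl

theorem continuous_coe_jordanTorus (c : ι → ℤ) :
    Continuous fun t => (jordanTorus (lam := lam) c t).val := by
  simp only [coe_jordanTorus]
  exact Continuous.matrix_diagonal
    (continuous_pi fun a => Units.continuous_val.comp (continuous_zpow _))

theorem commute_jordanTorus (c : ι → ℤ) (t : ℂˣ) :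
    Commute (jordanTorus (lam := lam) c t).val (nilpotentJordan lam) := by
  rw [coe_jordanTorus, commute_iff_eq]
  ext a b
  rw [Matrix.diagonal_mul, Matrix.mul_diagonal]
  by_cases h : a.1 = b.1
  · rw [h, mul_comm]
  · simp [nilpotentJordan, h]

theorem det_jordanTorus (c : ι → ℤ) (t : ℂˣ) :
    (jordanTorus (lam := lam) c t).val.det = ((t ^ ∑ i, lam i * c i : ℂˣ) : ℂ) := by
  rw [coe_jordanTorus, Matrix.det_diagonal, ← Units.coe_prod, Finset.prod_zpow_eq_zpow_sum,
    Fintype.sum_sigma]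
  simp

theorem jordanChar_jordanTorus {c : ι → ℤ} {d M : ℕ} (hd0 : d ≠ 0)
    (hd : ∀ i, d ∣ lam i) (hM : ∀ i, lam i ≤ d * M) (hc : ∑ i, lam i * c i = d) (t : ℂˣ) :
    jordanChar d M (jordanTorus (lam := lam) c t).val = t := by
  obtain ⟨m, hm⟩ : ∃ m : ℤ, ∀ t : ℂˣ,
      jordanChar d M (jordanTorus (lam := lam) c t).val = ((t ^ m : ℂˣ) : ℂ) := by
    refine ⟨∑ q ∈ Finset.range M,
      ∑ a : {a : Σ i, Fin (lam i) // jordanHeight a = d * q}, c a.1.1, fun t => ?_⟩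
    rw [← Finset.prod_zpow_eq_zpow_sum, Units.coe_prod, jordanChar]
    refine Finset.prod_congr rfl fun q _ => ?_
    have : (jordanTorus (lam := lam) c t).val.toSquareBlock jordanHeight (d * q) =
        Matrix.diagonal fun a => ((t ^ c a.1.1 : ℂˣ) : ℂ) := by
      ext a b
      simp [Matrix.toSquareBlock_def, coe_jordanTorus, Matrix.diagonal_apply, Subtype.ext_iff]
    rw [this, Matrix.det_diagonal, ← Units.coe_prod, Finset.prod_zpow_eq_zpow_sum]
  have h2 := jordanChar_pow (commute_jordanTorus c (Units.mk0 (2 : ℂ) two_ne_zero)) hd hM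
  rw [hm, det_jordanTorus, hc, ← Units.val_pow_eq_pow_val, ← zpow_natCast, ← zpow_mul] at h2
  have h3 : (2 : ℂ) ^ (m * d) = (2 : ℂ) ^ (d : ℤ) := by simpa using h2
  have h4 : m * d = d := by
    have : (2 : ℝ) ^ (m * d) = (2 : ℝ) ^ (d : ℤ) := Complex.ofReal_injective (by push_cast; exact h3)
    exact zpow_right_injective₀ (by norm_num) (by norm_num) this
  have h5 : m = 1 := by
    have : (d : ℤ) ≠ 0 := by exact_mod_cast hd0
    exact mul_right_cancel₀ this (by rw [h4, one_mul])
  rw [hm, h5, zpow_one]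

end

theorem exists_sum_mul_eq_gcd {ι : Type*} (s : Finset ι) (f : ι → ℕ) :
    ∃ c : ι → ℤ, ∑ i ∈ s, (f i : ℤ) * c i = (s.gcd f : ℕ) := by
  obtain ⟨c, hc⟩ := s.gcd_eq_sum_mul fun i => (f i : ℤ)
  have hdvd : s.gcd (fun i => (f i : ℤ)) ∣ (s.gcd f : ℕ) :=
    Int.dvd_natCast.2 (Finset.dvd_gcd fun i hi => Int.natAbs_dvd_natAbs.2 (Finset.gcd_dvd hi))
  obtain ⟨y, hy⟩ := hdvd
  refine ⟨fun i => c i * y, ?_⟩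
  rw [hy, hc, Finset.sum_mul]
  exact Finset.sum_congr rfl fun i _ => (mul_assoc _ _ _).symm

/-- The sum of the first `m` block sizes. -/
def blockStart {k : ℕ} (lam : Fin k → ℕ) (m : ℕ) : ℕ :=
  ∑ i ∈ Finset.univ.filter fun i : Fin k => (i : ℕ) < m, lam i

theorem finSigmaFinEquiv_val_eq_blockStart_add {k : ℕ} {lam : Fin k → ℕ} (a : Σ i, Fin (lam i)) :
    (finSigmaFinEquiv a : ℕ) = blockStart lam a.1 + a.2 := by
  rw [finSigmaFinEquiv_apply]
  congr 1
  symm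
  refine Finset.sum_bij' (fun i hi => ⟨i, (Finset.mem_filter.1 hi).2⟩)
    (fun i _ => Fin.castLE a.1.2.le i) ?_ ?_ ?_ ?_ ?_ <;> simp [-Fin.val_fin_lt]

theorem blockStart_succ {k : ℕ} (lam : Fin k → ℕ) (j : Fin k) :
    blockStart lam (j + 1) = blockStart lam j + lam j := by
  have : (Finset.univ.filter fun i : Fin k => (i : ℕ) < (j : ℕ) + 1) =
      insert j (Finset.univ.filter fun i : Fin k => (i : ℕ) < (j : ℕ)) := by
    ext i
    simp [Fin.ext_iff]
    omega
  rw [blockStart, this, Finset.sum_insert (by simp), add_comm]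
  rfl

theorem blockStart_mono {k : ℕ} (lam : Fin k → ℕ) {m m' : ℕ} (h : m ≤ m') :
    blockStart lam m ≤ blockStart lam m' :=
  Finset.sum_le_sum_of_subset
    (Finset.monotone_filter_right _ fun _ _ hi => lt_of_lt_of_le hi h)

/-- Consecutive indices not separated by a block boundary are consecutive in a common block. -/
theorem finSigmaFinEquiv_succ_iff {k : ℕ} {lam : Fin k → ℕ} (a b : Σ i, Fin (lam i)) :
    ((finSigmaFinEquiv b : ℕ) = (finSigmaFinEquiv a : ℕ) + 1 ∧
      ∀ m : Fin (k + 1), (finSigmaFinEquiv b : ℕ) ≠ blockStart lam m) ↔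
    a.1 = b.1 ∧ (b.2 : ℕ) = a.2 + 1 := by
  constructor
  · rintro ⟨h, hm⟩
    obtain ⟨i, p, hp⟩ := a
    by_cases hp' : p + 1 < lam i
    · have : b = ⟨i, p + 1, hp'⟩ := by
        apply finSigmaFinEquiv.injective
        apply Fin.ext
        rw [h, finSigmaFinEquiv_val_eq_blockStart_add, finSigmaFinEquiv_val_eq_blockStart_add]
        rfl
      subst this
      exact ⟨rfl, rfl⟩
    · refine absurd ?_ (hm i.succ)
      rw [h, finSigmaFinEquiv_val_eq_blockStart_add, Fin.val_succ, blockStart_succ]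
      dsimp only
      omega
  · obtain ⟨i, p, hp⟩ := a
    obtain ⟨j, q, hq⟩ := b
    rintro ⟨rfl : i = j, rfl : q = p + 1⟩
    rw [finSigmaFinEquiv_val_eq_blockStart_add, finSigmaFinEquiv_val_eq_blockStart_add]
    refine ⟨rfl, fun m hm => ?_⟩
    dsimp only at hm
    rcases le_or_gt (m : ℕ) i with h | h
    · have := blockStart_mono lam h
      omega
    · have := blockStart_mono lam (Nat.succ_le_of_lt h)
      rw [Nat.succ_eq_add_one, blockStart_succ] at this
      omega

/-- Let `λ_1 ≥ … ≥ λ_k ≥ 1` with `λ_1 + … + λ_k = l`, `d = gcd(λ_1, …, λ_k)`, and let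
`e` be the nilpotent `l × l` complex matrix in Jordan form with blocks of sizes
`λ_1, …, λ_k` (so `e` has a `1` in entry `(a, a+1)` exactly when `a + 1` is not one of
the block boundaries `λ_1 + … + λ_m`, and `0` elsewhere).  Let `Z` be the centralizer
of `e` in `SL_l(ℂ)`, viewed inside the (topological) group of invertible `l × l`
matrices, and `Z₀` its identity component.  Then the component group `Z / Z₀` is cyclic
of order `d`. -/
theorem component_group_of_centralizer_in_SL_is_cyclic_of_order_gcd
    (k l : ℕ) (hk : 1 ≤ k) (lam : Fin k → ℕ)
    (hmono : ∀ i j : Fin k, i ≤ j → lam j ≤ lam i)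
    (hpos : ∀ j : Fin k, 1 ≤ lam j)
    (hsum : ∑ j : Fin k, lam j = l)
    (d : ℕ) (hd : d = Finset.univ.gcd lam)
    (e : Matrix (Fin l) (Fin l) ℂ)
    (he : ∀ a b : Fin l, e a b =
      if (b : ℕ) = (a : ℕ) + 1 ∧
          ∀ m : Fin (k + 1),
            (b : ℕ) ≠ ∑ i ∈ Finset.univ.filter fun i : Fin k => (i : ℕ) < (m : ℕ), lam i
        then 1 else 0)
    (Z : Subgroup (Matrix (Fin l) (Fin l) ℂ)ˣ)
    (hZ : ∀ g : (Matrix (Fin l) (Fin l) ℂ)ˣ, g ∈ Z ↔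
      (g : Matrix (Fin l) (Fin l) ℂ).det = 1 ∧
        (g : Matrix (Fin l) (Fin l) ℂ) * e = e * (g : Matrix (Fin l) (Fin l) ℂ))
    (Z₀ : Subgroup Z) (hZ₀ : (Z₀ : Set Z) = connectedComponent 1) [Z₀.Normal] :
    IsCyclic (Z ⧸ Z₀) ∧ Nat.card (Z ⧸ Z₀) = d := by
  subst hsum hd
  let φ : (Σ i, Fin (lam i)) ≃ Fin (∑ j, lam j) := finSigmaFinEquiv
  let R : Matrix (Fin (∑ j, lam j)) (Fin (∑ j, lam j)) ℂ ≃ₐ[ℂ]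
      Matrix (Σ i, Fin (lam i)) (Σ i, Fin (lam i)) ℂ := Matrix.reindexAlgEquiv ℂ ℂ φ.symm
  have hR : ∀ x, R x = x.submatrix φ φ := fun x => rfl
  have hRe : R e = nilpotentJordan lam := by
    ext a b
    rw [hR, Matrix.submatrix_apply, he]
    exact if_congr (finSigmaFinEquiv_succ_iff a b) rfl rfl
  let i₀ : Fin k := ⟨0, hk⟩
  have hdvd : ∀ i, Finset.univ.gcd lam ∣ lam i := fun i => Finset.gcd_dvd (Finset.mem_univ i)
  have hd0 : Finset.univ.gcd lam ≠ 0 := fun h =>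
    absurd (Finset.gcd_eq_zero_iff.1 h i₀ (Finset.mem_univ _)) (Nat.one_le_iff_ne_zero.1 (hpos i₀))
  have hM : ∀ i, lam i ≤ Finset.univ.gcd lam * lam i₀ := fun i =>
    (hmono i₀ i (Nat.zero_le _)).trans (Nat.le_mul_of_pos_left _ (Nat.pos_of_ne_zero hd0))
  obtain ⟨c, hc⟩ := exists_sum_mul_eq_gcd Finset.univ lam
  have hcomm : ∀ x, x ∈ Subalgebra.centralizer ℂ {e} ↔ Commute (R x) (nilpotentJordan lam) := by
    intro x
    rw [← hRe, Subalgebra.mem_centralizer_iff, commute_iff_eq, ← map_mul, ← map_mul,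
      R.injective.eq_iff]
    simp [eq_comm]
  have hcont : Continuous R.symm := continuous_matrix fun i j => continuous_id.matrix_elem _ _
  have hdet : ∀ x, (R x).det = x.det := fun x => Matrix.det_submatrix_equiv_self φ x
  refine isCyclic_componentGroup_of_pow_eq_det hd0 (Subalgebra.centralizer ℂ {e})
    (fun x => jordanChar (Finset.univ.gcd lam) (lam i₀) (R x)) ?_ ?_ ?_ ?_
    ((Units.map R.symm.toMulEquiv.toMonoidHom).comp (jordanTorus (lam := lam) c)) ?_ ?_ ?_ Z ?_ Z₀ hZ₀
  · refine (continuous_jordanChar _ _).comp ?_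
    exact continuous_matrix fun i j => continuous_id.matrix_elem _ _
  · simpa using jordanChar_jordanTorus hd0 hdvd hM hc 1
  · intro x hx y hy
    rw [map_mul, jordanChar_mul _ _ ((hcomm x).1 hx) ((hcomm y).1 hy)]
  · intro x hx
    rw [jordanChar_pow ((hcomm x).1 hx) hdvd hM, hdet]
  · exact Matrix.continuous_units_of_continuous_val (hcont.comp (continuous_coe_jordanTorus c))
  · intro t
    rw [hcomm]
    simpa using commute_jordanTorus c t
  · intro t
    simpa using jordanChar_jordanTorus hd0 hdvd hM hc t
  · intro g
    rw [hZ, Subalgebra.mem_centralizer_iff]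
    simp [eq_comm]
end
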